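/- Let A and B be groups. Suppose there exist real Hilbert spaces H_A, H_B, maps R_A, S_A : A → H_A and R_B, S_B : B → H_B, and proper functions φ_A : A → ℝ and φ_B : B → ℝ such that φ_A(y⁻¹x) = ‖R_A(x) − R_A(y)‖² + ‖S_A(x) + S_A(y)‖² for all x, y ∈ A, and φ_B(y⁻¹x) = ‖R_B(x) − R_B(y)‖² + ‖S_B(x) + S_B(y)‖² for all x, y ∈ B. Then there exist a real Hilbert space H, maps R, S : A ∗ B → H, and a proper function φ : A ∗ B → ℝ such that φ(y⁻¹x) = ‖R(x) − R(y)‖² + ‖S(x) + S(y)‖² for all x, y ∈ A ∗ B. -/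

import Mathlib

/-- A function `φ : G → ℝ` is proper if every sublevel set is finite. -/
def ProperFun {G : Type*} (φ : G → ℝ) : Prop :=
  ∀ C : ℝ, 0 < C → {g : G | φ g ≤ C}.Finite

/-- Knudby's data witnessing the weak Haagerup property with constant `1`: a real
Hilbert space `H`, maps `R, S : G → H` and a proper function `φ : G → ℝ` with
`φ (y⁻¹ * x) = ‖R x - R y‖² + ‖S x + S y‖²` for all `x, y`. -/
structure WHOneData (G : Type*) [Group G] where
  H : Type
  [nacg : NormedAddCommGroup H]
  [ips : InnerProductSpace ℝ H]
  [cs : CompleteSpace H]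
  φ : G → ℝ
  R : G → H
  S : G → H
  proper : ProperFun φ
  identity : ∀ x y : G, φ (y⁻¹ * x) = ‖R x - R y‖ ^ 2 + ‖S x + S y‖ ^ 2

/-- Positive definite real kernels. -/
def PDK {X : Type*} (K : X → X → ℝ) : Prop :=
  (∀ x y, K x y = K y x) ∧
    ∀ (n : ℕ) (x : Fin n → X) (c : Fin n → ℝ), 0 ≤ ∑ i, ∑ j, c i * c j * K (x i) (x j)

namespace PDK

open Filter Topology

theorem of_inner {X H : Type*} [NormedAddCommGroup H] [InnerProductSpace ℝ H] (f : X → H) :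
    PDK (fun x y => inner ℝ (f x) (f y)) := by
  refine ⟨fun x y => real_inner_comm _ _, fun n x c => ?_⟩
  have h : ∑ i, ∑ j, c i * c j * inner ℝ (f (x i)) (f (x j))
      = inner ℝ (∑ i, c i • f (x i)) (∑ i, c i • f (x i)) := by
    rw [sum_inner]
    refine Finset.sum_congr rfl fun i _ => ?_
    rw [inner_sum]
    refine Finset.sum_congr rfl fun j _ => ?_
    rw [real_inner_smul_left, real_inner_smul_right]; ring
  rw [h]
  exact real_inner_self_nonneg

theorem sum_nonneg' {X ι : Type*} [Fintype ι] {K : X → X → ℝ} (hK : PDK K) (x : ι → X)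
    (c : ι → ℝ) : 0 ≤ ∑ i, ∑ j, c i * c j * K (x i) (x j) := by
  have e := Fintype.equivFin ι
  have := hK.2 _ (x ∘ e.symm) (c ∘ e.symm)
  convert this using 1
  rw [← e.symm.sum_comp]
  refine Finset.sum_congr rfl fun i _ => ?_
  rw [← e.symm.sum_comp]; rfl

theorem exists_inner.{u} {X : Type u} {K : X → X → ℝ} (hK : PDK K) :
    ∃ (H : Type u) (_ : NormedAddCommGroup H) (_ : InnerProductSpace ℝ H) (_ : CompleteSpace H)
      (f : X → H), ∀ x y, inner ℝ (f x) (f y) = K x y := by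
  let K' : Matrix X X (ℝ →L[ℝ] ℝ) := .of fun x y => K x y • ContinuousLinearMap.id ℝ ℝ
  have hps : K'.PosSemidef := by
    have tf := ((RKHS.posSemidef_tfae (K := K')).out 2 0)
    refine tf.mp ⟨?_, ?_⟩
    · ext x y
      simp [K', Matrix.conjTranspose_apply, hK.1 x y]
      have : star (ContinuousLinearMap.id ℝ ℝ) = ContinuousLinearMap.id ℝ ℝ := star_one _
      simp [this]
    · intro vv
      have := hK.sum_nonneg' (ι := vv.support) (fun i => i.1) (fun i => vv i.1)
      simp only [Finsupp.sum, K', Matrix.of_apply]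
      rw [Finset.sum_coe_sort vv.support
        (fun i => ∑ j : vv.support, vv i * vv j.1 * K i j.1)] at this
      convert this using 1
      simp only [RCLike.re_to_real]
      refine Finset.sum_congr rfl fun i _ => ?_
      rw [Finset.sum_coe_sort vv.support (fun j => vv i * vv j * K i j)]
      refine Finset.sum_congr rfl fun j _ => ?_
      simp [hK.1 i j]; ring
  have : Fact K'.PosSemidef := ⟨hps⟩
  refine ⟨RKHS.OfKernel K', inferInstance, inferInstance, inferInstance,
    fun x => RKHS.kerFun (RKHS.OfKernel K') x 1, fun x y => ?_⟩
  rw [← RKHS.kernel_inner, RKHS.OfKernel.kernel_ofKernel]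
  simp [K', hK.1 x y]

theorem comap {X Y : Type*} {K : X → X → ℝ} (hK : PDK K) (g : Y → X) :
    PDK (fun x y => K (g x) (g y)) :=
  ⟨fun _ _ => hK.1 _ _, fun n x c => hK.2 n (g ∘ x) c⟩

theorem zero {X : Type*} : PDK (fun _ _ : X => (0 : ℝ)) :=
  ⟨fun _ _ => rfl, fun n x c => by simp⟩

theorem add {X : Type*} {K L : X → X → ℝ} (hK : PDK K) (hL : PDK L) :
    PDK (fun x y => K x y + L x y) := by
  refine ⟨fun x y => by simp only [hK.1 x y, hL.1 x y], fun n x c => ?_⟩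
  simp only [mul_add, Finset.sum_add_distrib]
  exact add_nonneg (hK.2 n x c) (hL.2 n x c)

theorem const_mul {X : Type*} {K : X → X → ℝ} (hK : PDK K) {a : ℝ} (ha : 0 ≤ a) :
    PDK (fun x y => a * K x y) := by
  refine ⟨fun x y => by simp only [hK.1 x y], fun n x c => ?_⟩
  have : ∑ i, ∑ j, c i * c j * (a * K (x i) (x j)) = a * ∑ i, ∑ j, c i * c j * K (x i) (x j) := by
    simp only [Finset.mul_sum]
    refine Finset.sum_congr rfl fun i _ => Finset.sum_congr rfl fun j _ => by ring
  rw [this]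
  exact mul_nonneg ha (hK.2 n x c)

theorem sum {X ι : Type*} (s : Finset ι) {K : ι → X → X → ℝ} (hK : ∀ i ∈ s, PDK (K i)) :
    PDK (fun x y => ∑ i ∈ s, K i x y) := by
  classical
  induction s using Finset.induction_on with
  | empty => simpa using zero
  | insert a s ha ih =>
    simp only [Finset.sum_insert ha]
    exact (hK a (by simp)).add (ih fun i hi => hK i (by simp [hi]))

theorem of_tendsto {X : Type*} {K : ℕ → X → X → ℝ} {L : X → X → ℝ} (hK : ∀ n, PDK (K n))
    (h : ∀ x y, Tendsto (fun n => K n x y) atTop (𝓝 (L x y))) : PDK L := by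
  refine ⟨fun x y => tendsto_nhds_unique (h x y) ?_, fun n x c => ?_⟩
  · simpa only [fun n => (hK n).1 x y] using h y x
  · refine ge_of_tendsto' (b := 0) (f := fun m => ∑ i, ∑ j, c i * c j * K m (x i) (x j))
      (x := atTop) ?_ (fun m => (hK m).2 n x c)
    exact tendsto_finsetSum _ fun i _ => tendsto_finsetSum _ fun j _ => (h _ _).const_mul _

theorem of_hasSum {X : Type*} {K : ℕ → X → X → ℝ} {L : X → X → ℝ} (hK : ∀ n, PDK (K n))
    (h : ∀ x y, HasSum (fun n => K n x y) (L x y)) : PDK L :=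
  of_tendsto (K := fun n x y => ∑ i ∈ Finset.range n, K i x y)
    (fun _ => sum _ fun i _ => hK i) fun x y => (h x y).tendsto_sum_nat

theorem rankOne {X : Type*} (f : X → ℝ) : PDK (fun x y => f x * f y) := by
  have := of_inner f
  simpa [mul_comm] using this

theorem mul {X : Type*} {K L : X → X → ℝ} (hK : PDK K) (hL : PDK L) :
    PDK (fun x y => K x y * L x y) := by
  refine ⟨fun x y => by simp only [hK.1 x y, hL.1 x y], fun n x c => ?_⟩
  have key : ∀ {M : X → X → ℝ}, PDK M → (Matrix.of fun i j => M (x i) (x j)).PosSemidef := by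
    intro M hM
    rw [Matrix.posSemidef_iff_dotProduct_mulVec]
    refine ⟨by ext i j; simp [hM.1 (x i) (x j)], fun d => ?_⟩
    convert hM.2 n x d using 1
    · rfl
    simp only [dotProduct, Matrix.mulVec, Finset.mul_sum]
    refine Finset.sum_congr rfl fun i _ => Finset.sum_congr rfl fun j _ => ?_
    simp only [Matrix.of_apply, Pi.star_apply, star_trivial]
    ring
  have h := (key hK).hadamard (key hL)
  rw [Matrix.posSemidef_iff_dotProduct_mulVec] at h
  convert h.2 c using 1
  · rfl
  simp only [dotProduct, Matrix.mulVec, Finset.mul_sum]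
  refine Finset.sum_congr rfl fun i _ => Finset.sum_congr rfl fun j _ => ?_
  simp only [Matrix.of_apply, Matrix.hadamard_apply, Pi.star_apply, star_trivial]
  ring

theorem one {X : Type*} : PDK (fun _ _ : X => (1 : ℝ)) := by
  simpa using rankOne (fun _ : X => (1 : ℝ))

theorem pow {X : Type*} {K : X → X → ℝ} (hK : PDK K) (n : ℕ) : PDK (fun x y => K x y ^ n) := by
  induction n with
  | zero => simpa using one
  | succ n ih => simpa only [pow_succ] using ih.mul hK

theorem exp {X : Type*} {K : X → X → ℝ} (hK : PDK K) : PDK (fun x y => Real.exp (K x y)) := by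
  refine of_hasSum (K := fun n x y => ((n.factorial : ℝ))⁻¹ * K x y ^ n)
    (fun n => (hK.pow n).const_mul (by positivity)) fun x y => ?_
  have := NormedSpace.expSeries_div_hasSum_exp (K x y)
  rw [← Real.exp_eq_exp_ℝ] at this
  simpa [div_eq_inv_mul] using this

theorem sinh {X : Type*} {K : X → X → ℝ} (hK : PDK K) : PDK (fun x y => Real.sinh (K x y)) := by
  refine of_hasSum (K := fun n x y => (((2 * n + 1).factorial : ℝ))⁻¹ * K x y ^ (2 * n + 1))
    (fun n => (hK.pow _).const_mul (by positivity)) fun x y => ?_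
  have := Real.hasSum_sinh (K x y)
  simpa [div_eq_inv_mul] using this

theorem eqKer {X : Type*} [DecidableEq X] : PDK (fun x y : X => if x = y then (1 : ℝ) else 0) := by
  refine ⟨fun x y => by simp [eq_comm], fun n x c => ?_⟩
  have : ∑ i, ∑ j, c i * c j * (if x i = x j then (1 : ℝ) else 0)
      = ∑ a ∈ Finset.univ.image x, (∑ i, if x i = a then c i else 0) ^ 2 := by
    have h2 : ∀ a, (∑ i, if x i = a then c i else 0) ^ 2
        = ∑ i, ∑ j, if x i = a then (if x j = a then c i * c j else 0) else 0 := by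
      intro a
      rw [sq, Finset.sum_mul_sum]
      refine Finset.sum_congr rfl fun i _ => Finset.sum_congr rfl fun j _ => ?_
      split_ifs <;> simp
    simp only [h2]
    rw [Finset.sum_comm (s := Finset.univ.image x)]
    refine Finset.sum_congr rfl fun i _ => ?_
    rw [Finset.sum_comm]
    refine Finset.sum_congr rfl fun j _ => ?_
    rw [Finset.sum_ite_eq]
    simp [eq_comm]
  rw [this]
  positivity

/-- Krein-type projection of a kernel. -/
theorem proj {X : Type*} {K : X → X → ℝ} (hK : PDK K) (f : X → ℝ) (e : X) :
    PDK (fun x y => K x y - f y * K x e - f x * K e y + f x * f y * K e e) := by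
  obtain ⟨H, _, _, _, F, hF⟩ := hK.exists_inner
  convert of_inner (fun x => F x - f x • F e) using 3 with x y
  simp only [inner_sub_left, inner_sub_right, real_inner_smul_left, real_inner_smul_right, hF]
  ring

theorem diag_nonneg {X : Type*} {K : X → X → ℝ} (hK : PDK K) (x : X) : 0 ≤ K x x := by
  simpa using hK.2 1 (fun _ => x) (fun _ => 1)

theorem abs_le {X : Type*} {K : X → X → ℝ} (hK : PDK K) (x y : X) :
    |K x y| ≤ (K x x + K y y) / 2 := by
  have h1 := hK.2 2 ![x, y] ![1, 1]
  have h2 := hK.2 2 ![x, y] ![1, -1]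
  simp [Fin.sum_univ_two, hK.1 y x] at h1 h2
  rw [_root_.abs_le]; constructor <;> linarith

end PDK

/-- Kernel form of Knudby's data. -/
def WHK (G : Type*) [Group G] : Prop :=
  ∃ φ : G → ℝ, ProperFun φ ∧ ∃ P Q : G → G → ℝ, PDK P ∧ PDK Q ∧
    ∀ x y, φ (y⁻¹ * x) = (P x x + P y y - 2 * P x y) + (Q x x + Q y y + 2 * Q x y)

/-- Approximation form: multipliers with small negative part. -/
def ApproxWH (G : Type*) [Group G] : Prop :=
  ∀ F : Set G, F.Finite → ∀ ε : ℝ, 0 < ε → ∃ (m : G → ℝ) (P Q : G → G → ℝ), PDK P ∧ PDK Q ∧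
    (∀ x y, m (y⁻¹ * x) = P x y - Q x y) ∧ m 1 = 1 ∧ (∀ x, Q x x ≤ ε) ∧
    (∀ g ∈ F, |1 - m g| ≤ ε) ∧ ∀ η : ℝ, 0 < η → {g | η ≤ |m g|}.Finite

theorem WHOneData.toWHK {G : Type*} [Group G] (d : WHOneData G) : WHK G := by
  obtain ⟨H, φ, R, S, hp, hid⟩ := d
  refine ⟨φ, hp, _, _, PDK.of_inner R, PDK.of_inner S, fun x y => ?_⟩
  rw [hid, norm_sub_sq_real, norm_add_sq_real, real_inner_self_eq_norm_sq,
    real_inner_self_eq_norm_sq, real_inner_self_eq_norm_sq, real_inner_self_eq_norm_sq]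
  ring

theorem ProperFun.countable {G : Type*} {φ : G → ℝ} (h : ProperFun φ) : Countable G := by
  rw [← Set.countable_univ_iff]
  have : (Set.univ : Set G) = ⋃ n : ℕ, {g | φ g ≤ (n : ℝ) + 1} := by
    ext g
    obtain ⟨n, hn⟩ := exists_nat_ge (φ g)
    simp only [Set.mem_univ, Set.mem_iUnion, Set.mem_ofPred_eq, true_iff]
    exact ⟨n, by linarith⟩
  rw [this]
  exact Set.countable_iUnion fun n => (h _ (by positivity)).countable

theorem WHK.toData {G : Type*} [Group G] (h : WHK G) : Nonempty (WHOneData G) := by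
  obtain ⟨φ, hp, P, Q, hP, hQ, hid⟩ := h
  have hc : Countable G := hp.countable
  let e : G ≃ Shrink.{0} G := equivShrink.{0} G
  obtain ⟨H1, _, _, _, f1, hf1⟩ := (hP.comap e.symm).exists_inner
  obtain ⟨H2, _, _, _, f2, hf2⟩ := (hQ.comap e.symm).exists_inner
  refine ⟨⟨WithLp 2 (H1 × H2), φ, fun x => WithLp.toLp 2 (f1 (e x), 0),
    fun x => WithLp.toLp 2 (0, f2 (e x)), hp, fun x y => ?_⟩⟩
  rw [hid, norm_sub_sq_real, norm_add_sq_real]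
  simp only [← real_inner_self_eq_norm_sq, WithLp.prod_inner_apply, hf1, hf2, inner_zero_left,
    Equiv.symm_apply_apply]
  ring

theorem WHK.comap {G G' : Type*} [Group G] [Group G'] (h : WHK G) (f : G' →* G)
    (hf : Function.Injective f) : WHK G' := by
  obtain ⟨φ, hp, P, Q, hP, hQ, hid⟩ := h
  refine ⟨φ ∘ f, fun C hC => ?_, _, _, hP.comap f, hQ.comap f, fun x y => ?_⟩
  · exact (hp C hC).preimage hf.injOn
  · simp [← hid]

open Filter Topology in
theorem WHK.approx {G : Type*} [Group G] (h : WHK G) : ApproxWH G := by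
  obtain ⟨φ, hp, P, Q, hP, hQ, hid⟩ := h
  intro F hF ε hε
  set c := φ 1 / 4 with hc
  have hQc : ∀ x, Q x x = c := by
    intro x
    have := hid x x
    rw [inv_mul_cancel] at this
    rw [hc, this]; ring
  have ev1 : ∀ᶠ t : ℝ in 𝓝[>] 0, Real.exp (2 * t * c) * (2 * Real.sinh (2 * t * c)) < ε := by
    have : Tendsto (fun t : ℝ => Real.exp (2 * t * c) * (2 * Real.sinh (2 * t * c))) (𝓝[>] 0)
        (𝓝 (Real.exp (2 * 0 * c) * (2 * Real.sinh (2 * 0 * c)))) :=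
      (Continuous.tendsto (by fun_prop) 0).mono_left nhdsWithin_le_nhds
    exact this.eventually (gt_mem_nhds (by simpa using hε))
  have ev2 : ∀ g ∈ F, ∀ᶠ t : ℝ in 𝓝[>] 0, |1 - Real.exp (-t * (φ g - φ 1))| < ε := by
    intro g _
    have : Tendsto (fun t : ℝ => |1 - Real.exp (-t * (φ g - φ 1))|) (𝓝[>] 0)
        (𝓝 (|1 - Real.exp (-0 * (φ g - φ 1))|)) :=
      (Continuous.tendsto (by fun_prop) 0).mono_left nhdsWithin_le_nhds
    exact this.eventually (gt_mem_nhds (by simpa using hε))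
  have ev3 : ∀ᶠ t : ℝ in 𝓝[>] 0, 0 < t := eventually_mem_nhdsWithin
  obtain ⟨t, ⟨h1, h2⟩, ht⟩ := ((ev1.and ((Filter.eventually_all_finite hF).2 ev2)).and ev3).exists
  have hG : PDK (fun x y => Real.exp (2 * t * c) * (Real.exp (-t * P x x) * Real.exp (-t * P y y) *
      Real.exp (2 * t * P x y))) :=
    ((PDK.rankOne (fun x => Real.exp (-t * P x x))).mul
      (hP.const_mul (a := 2 * t) (by positivity)).exp).const_mul (by positivity)
  have hQ2 := hQ.const_mul (a := 2 * t) (by positivity)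
  refine ⟨fun g => Real.exp (-t * (φ g - φ 1)), _, _, hG.mul hQ2.exp,
    hG.mul (hQ2.sinh.const_mul (a := 2) (by norm_num)), fun x y => ?_, by simp, fun x => ?_,
    fun g hg => (h2 g hg).le, fun η hη => ?_⟩
  · have e1 : Real.exp (2 * t * Q x y) - 2 * Real.sinh (2 * t * Q x y)
        = Real.exp (-(2 * t * Q x y)) := by rw [Real.sinh_eq]; ring
    beta_reduce
    rw [← mul_sub, e1, ← Real.exp_add, ← Real.exp_add, ← Real.exp_add, ← Real.exp_add, hid,
      hQc, hQc]
    congr 1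
    rw [hc]; ring
  · have : Real.exp (-t * P x x) * Real.exp (-t * P x x) * Real.exp (2 * t * P x x) = 1 := by
      rw [← Real.exp_add, ← Real.exp_add, Real.exp_eq_one_iff]; ring
    simp only [this, hQc]
    simpa using h1.le
  · refine (hp (|φ 1 - Real.log η / t| + 1) (by positivity)).subset fun g hg => ?_
    simp only [Set.mem_ofPred_eq, Real.abs_exp] at hg ⊢
    have := (Real.log_le_iff_le_exp hη).2 hg
    have h3 : Real.log η / t ≤ -(φ g - φ 1) := by
      rw [div_le_iff₀ ht]; linarith
    have := le_abs_self (φ 1 - Real.log η / t)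
    linarith

theorem ApproxWH.toWHK {G : Type*} [Group G] [Countable G] (h : ApproxWH G) : WHK G := by
  obtain ⟨enc, henc⟩ := exists_injective_nat G
  have hF : ∀ n : ℕ, {g : G | enc g ≤ n}.Finite := fun n =>
    (Set.finite_le_nat n).preimage henc.injOn
  set ε : ℕ → ℝ := fun n => (1 / 2) ^ n / ((n : ℝ) + 1) with hεd
  have hε : ∀ n, 0 < ε n := fun n => by positivity
  have hwε : ∀ n : ℕ, ((n : ℝ) + 1) * ε n = (1 / 2) ^ n := fun n => by
    simp only [hεd]; field_simp
  have hgeo : HasSum (fun n : ℕ => (1 / 2 : ℝ) ^ n) 2 := hasSum_geometric_two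
  choose m P Q hP hQ hm hm1 hQd hmF hmc using fun n => h _ (hF n) (ε n) (hε n)
  have hQabs : ∀ n x y, |Q n x y| ≤ ε n := fun n x y => by
    have := (hQ n).abs_le x y
    linarith [hQd n x, hQd n y]
  have hPd : ∀ n x, P n x x = 1 + Q n x x := fun n x => by
    have := hm n x x
    rw [inv_mul_cancel, hm1] at this; linarith
  have hmle : ∀ n g, m n g ≤ 1 + 2 * ε n := fun n g => by
    have h1 := hm n g 1
    rw [inv_one, one_mul] at h1
    have h2 := (abs_le.1 ((hP n).abs_le g 1)).2
    have h3 := (abs_le.1 (hQabs n g 1)).1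
    have := hPd n g
    have := hPd n 1
    linarith [hQd n g, hQd n 1]
  -- the summands
  have hsQ : ∀ x y, Summable fun n : ℕ => ((n : ℝ) + 1) * Q n x y := fun x y => by
    refine Summable.of_norm_bounded hgeo.summable fun n => ?_
    rw [Real.norm_eq_abs, abs_mul, ← hwε, abs_of_pos (by positivity : (0 : ℝ) < (n : ℝ) + 1)]
    exact mul_le_mul_of_nonneg_left (hQabs n x y) (by positivity)
  have hsm : ∀ g, Summable fun n : ℕ => ((n : ℝ) + 1) * (2 * (1 - m n g)) := fun g => by
    rw [← summable_nat_add_iff (enc g)]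
    refine Summable.of_norm_bounded
      (((summable_nat_add_iff (enc g)).2 hgeo.summable).mul_left 2) fun n => ?_
    rw [Real.norm_eq_abs, abs_mul, ← hwε, abs_of_pos (by positivity), abs_mul, abs_two]
    have := hmF (n + enc g) g (by simp)
    have h2 : (0 : ℝ) < ((n + enc g : ℕ) : ℝ) + 1 := by positivity
    nlinarith [mul_le_mul_of_nonneg_left this h2.le]
  set φ0 : G → ℝ := fun g => ∑' n : ℕ, ((n : ℝ) + 1) * (2 * (1 - m n g)) with hφ0
  set QQ : G → G → ℝ := fun x y => ∑' n : ℕ, ((n : ℝ) + 1) * Q n x y with hQQ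
  have hφs : ∀ g, HasSum (fun n : ℕ => ((n : ℝ) + 1) * (2 * (1 - m n g))) (φ0 g) :=
    fun g => (hsm g).hasSum
  have hQs : ∀ x y, HasSum (fun n : ℕ => ((n : ℝ) + 1) * Q n x y) (QQ x y) :=
    fun x y => (hsQ x y).hasSum
  have hφ01 : φ0 1 = 0 := by simp [hφ0, hm1]
  have hQQpd : PDK QQ := PDK.of_hasSum (fun n => (hQ n).const_mul (by positivity)) hQs
  have hQQd : ∀ x, QQ x x ≤ 2 := fun x => by
    refine hasSum_le (fun n => ?_) (hQs x x) hgeo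
    rw [← hwε]
    exact mul_le_mul_of_nonneg_left (hQd n x) (by positivity)
  have hPPpd : PDK (fun x y => (φ0 x + φ0 y - φ0 (y⁻¹ * x)) / 2
      + (QQ x y - QQ x 1 - QQ 1 y + QQ 1 1)) := by
    refine PDK.of_hasSum (fun n => ((hP n).proj (fun _ => 1) 1).const_mul
      (a := (n : ℝ) + 1) (by positivity)) fun x y => ?_
    have := ((((hφs x).add (hφs y)).sub (hφs (y⁻¹ * x))).div_const 2).add
      ((((hQs x y).sub (hQs x 1)).sub (hQs 1 y)).add (hQs 1 1))
    convert this using 1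
    · rfl
    funext n
    have e1 := hm n x y
    have e2 := hm n x 1
    have e3 := hm n y 1
    have e4 := hm n 1 1
    have e5 := hm1 n
    simp only [inv_one, one_mul] at e2 e3 e4
    rw [(hP n).1 1 y, (hQ n).1 1 y, e1, e2, e3]
    rw [e5] at e4
    have e6 : P n 1 1 = 1 + Q n 1 1 := by linarith
    rw [e6]
    ring
  have htpd := PDK.rankOne (fun x => Real.sqrt (2 - QQ x x))
  have hsq : ∀ x, Real.sqrt (2 - QQ x x) * Real.sqrt (2 - QQ x x) = 2 - QQ x x := fun x =>
    Real.mul_self_sqrt (by linarith [hQQd x])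
  refine ⟨fun g => φ0 g + 8, ?_, _, _, hPPpd.add htpd, hQQpd.add htpd, fun x y => ?_⟩
  · intro C hC
    obtain ⟨n, hn⟩ := exists_nat_gt (C + 8)
    refine (hmc n (1 / 2) (by norm_num)).subset fun g hg => ?_
    simp only [Set.mem_ofPred_eq] at hg ⊢
    by_contra hlt
    push Not at hlt
    have hlt2 := (le_abs_self (m n g)).trans_lt hlt
    have hnn : ∀ k : ℕ, 0 ≤ ((k : ℝ) + 1) * (2 * (1 - m k g)) + 4 * (1 / 2) ^ k := fun k => by
      rw [← hwε]
      have h2 : (0 : ℝ) < (k : ℝ) + 1 := by positivity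
      nlinarith [mul_le_mul_of_nonneg_left (hmle k g) h2.le]
    have hle := le_hasSum ((hφs g).add (hgeo.mul_left 4)) n fun k _ => hnn k
    have h2 : (0 : ℝ) < (n : ℝ) + 1 := by positivity
    have h3 : (0 : ℝ) < (1 / 2 : ℝ) ^ n := by positivity
    nlinarith
  · have hx := hsq x
    have hy := hsq y
    have h1 := hQQpd.1 1 x
    have h2 := hQQpd.1 1 y
    simp only [inv_mul_cancel, hφ01]
    rw [h1, h2]
    linarith

namespace FreeProdWH

open Monoid Filter Topology

section
set_option linter.unusedSectionVars false
variable {ι : Type*} {G : ι → Type*} [∀ i, Group (G i)]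

/-- Product of letter weights. -/
noncomputable def wt (M : (Σ i, G i) → ℝ) (l : List (Σ i, G i)) : ℝ := (l.map M).prod

/-- The group element spelled by a list of letters. -/
def pr (l : List (Σ i, G i)) : CoprodI G := (l.map fun a => CoprodI.of a.2).prod

/-- Reduced lists. -/
def Red (l : List (Σ i, G i)) : Prop :=
  (∀ a ∈ l, a.2 ≠ 1) ∧ l.IsChain (fun a b => a.1 ≠ b.1)

/-- Formal inverse of a list. -/
def linv (l : List (Σ i, G i)) : List (Σ i, G i) :=
  (l.map fun a => (⟨a.1, a.2⁻¹⟩ : Σ i, G i)).reverse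

open Classical in
/-- The tree kernel built from a letter kernel. -/
noncomputable def tk (M : (Σ i, G i) → ℝ) (k : (Σ i, G i) → (Σ i, G i) → ℝ) :
    List (Σ i, G i) → List (Σ i, G i) → ℝ
  | a :: s, b :: t => wt M s * wt M t * k a b + (if a = b then tk M k s t else 0)
  | [], _ => 0
  | _ :: _, [] => 0

@[simp] theorem wt_nil (M : (Σ i, G i) → ℝ) : wt M [] = 1 := rfl
@[simp] theorem wt_cons (M : (Σ i, G i) → ℝ) (a s) : wt M (a :: s) = M a * wt M s := by
  simp [wt]
theorem wt_append (M : (Σ i, G i) → ℝ) (s t) : wt M (s ++ t) = wt M s * wt M t := by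
  simp [wt]
@[simp] theorem pr_nil : pr ([] : List (Σ i, G i)) = 1 := rfl
@[simp] theorem pr_cons (a : Σ i, G i) (s) : pr (a :: s) = CoprodI.of a.2 * pr s := by
  simp [pr]
theorem pr_append (s t : List (Σ i, G i)) : pr (s ++ t) = pr s * pr t := by
  simp [pr]

theorem pr_linv (l : List (Σ i, G i)) : pr (linv l) = (pr l)⁻¹ := by
  induction l with
  | nil => simp [linv]
  | cons a s ih =>
    have : linv (a :: s) = linv s ++ [⟨a.1, a.2⁻¹⟩] := by simp [linv]
    rw [this, pr_append, ih]; simp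

theorem wt_linv (M : (Σ i, G i) → ℝ) (hinv : ∀ i (g : G i), M ⟨i, g⁻¹⟩ = M ⟨i, g⟩)
    (l : List (Σ i, G i)) : wt M (linv l) = wt M l := by
  induction l with
  | nil => simp [linv]
  | cons a s ih =>
    have : linv (a :: s) = linv s ++ [⟨a.1, a.2⁻¹⟩] := by simp [linv]
    rw [this, wt_append, ih]; simp [hinv, mul_comm]

theorem Red.tail {a : Σ i, G i} {s} (h : Red (a :: s)) : Red s :=
  ⟨fun b hb => h.1 b (by simp [hb]), h.2.tail⟩

theorem red_join {x y : List (Σ i, G i)} (hx : Red x) (hy : Red y)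
    (h : ∀ a ∈ x.head?, ∀ b ∈ y.head?, a.1 ≠ b.1) : Red (linv y ++ x) := by
  refine ⟨fun a ha => ?_, ?_⟩
  · rcases List.mem_append.1 ha with ha | ha
    · simp only [linv, List.mem_reverse, List.mem_map] at ha
      obtain ⟨b, hb, rfl⟩ := ha
      simpa using hy.1 b hb
    · exact hx.1 a ha
  · rw [List.isChain_append]
    refine ⟨?_, hx.2, ?_⟩
    · rw [linv, List.isChain_reverse, List.isChain_map]
      exact hy.2.imp fun a b hab => by simpa [flip] using hab.symm
    · intro b hb a ha
      simp only [linv, List.getLast?_reverse, List.head?_map, Option.mem_def,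
        Option.map_eq_some_iff] at hb
      obtain ⟨c, hc, rfl⟩ := hb
      exact (h a ha c hc).symm

theorem tk_sub (M : (Σ i, G i) → ℝ) (k k1 k2 : (Σ i, G i) → (Σ i, G i) → ℝ)
    (h : ∀ a b, k a b = k1 a b - k2 a b) (x y) : tk M k x y = tk M k1 x y - tk M k2 x y := by
  induction x generalizing y with
  | nil => simp [tk]
  | cons a s ih =>
    cases y with
    | nil => simp [tk]
    | cons b t =>
      simp only [tk, h, ih]
      split_ifs <;> ring

variable [DecidableEq ι] [∀ i, DecidableEq (G i)]

/-- Normal form of an element. -/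
def nf (g : CoprodI G) : List (Σ i, G i) := (CoprodI.Word.equiv g).toList

theorem red_nf (g : CoprodI G) : Red (nf g) :=
  ⟨fun a ha => (CoprodI.Word.equiv g).ne_one a ha, (CoprodI.Word.equiv g).chain_ne⟩

theorem pr_nf (g : CoprodI G) : pr (nf g) = g :=
  CoprodI.Word.equiv.symm_apply_apply g

theorem nf_pr {l : List (Σ i, G i)} (h : Red l) : nf (pr l) = l := by
  let w : CoprodI.Word G := ⟨l, fun a ha => h.1 a ha, h.2⟩
  have : CoprodI.Word.equiv (pr l) = w := CoprodI.Word.equiv.apply_symm_apply w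
  rw [nf, this]

theorem nf_injective : Function.Injective (nf (G := G)) := fun a b h => by
  rw [← pr_nf a, h, pr_nf]

theorem tk_formula (M : (Σ i, G i) → ℝ) (hinv : ∀ i (g : G i), M ⟨i, g⁻¹⟩ = M ⟨i, g⟩)
    (h1 : ∀ i, M ⟨i, 1⟩ = 1)
    (k : (Σ i, G i) → (Σ i, G i) → ℝ)
    (hk : ∀ i (g h : G i), k ⟨i, g⟩ ⟨i, h⟩ = M ⟨i, h⁻¹ * g⟩ - M ⟨i, g⟩ * M ⟨i, h⟩)
    (hk0 : ∀ a b, a.1 ≠ b.1 → k a b = 0)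
    (x y : List (Σ i, G i)) (hx : Red x) (hy : Red y) :
    wt M (nf ((pr y)⁻¹ * pr x)) = wt M x * wt M y + tk M k x y := by
  have main : ∀ x y : List (Σ i, G i), Red x → Red y →
      (∀ a ∈ x.head?, ∀ b ∈ y.head?, a.1 ≠ b.1) →
      wt M (nf ((pr y)⁻¹ * pr x)) = wt M x * wt M y := by
    intro x y hx hy h
    rw [← pr_linv, ← pr_append, nf_pr (red_join hx hy h), wt_append, wt_linv M hinv, mul_comm]
  induction x generalizing y with
  | nil => rw [main _ _ hx hy (by simp)]; simp [tk]
  | cons a s ih =>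
    cases y with
    | nil => rw [main _ _ hx hy (by simp)]; simp [tk]
    | cons b t =>
      by_cases hab : a = b
      · subst hab
        have e : (pr (a :: t))⁻¹ * pr (a :: s) = (pr t)⁻¹ * pr s := by
          simp only [pr_cons]; group
        rw [e, ih t hx.tail hy.tail]
        have := hk a.1 a.2 a.2
        rw [inv_mul_cancel, h1] at this
        simp only [wt_cons, tk, if_true]
        rw [show k a a = 1 - M a * M a from this]
        ring
      · by_cases hi : a.1 = b.1
        · obtain ⟨i, g⟩ := a
          obtain ⟨j, h⟩ := b
          obtain rfl : i = j := hi
          have hgh : h⁻¹ * g ≠ 1 := by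
            intro h0
            exact hab (by rw [inv_mul_eq_one.1 h0])
          have e : (pr (⟨i, h⟩ :: t))⁻¹ * pr (⟨i, g⟩ :: s)
              = (pr t)⁻¹ * pr (⟨i, h⁻¹ * g⟩ :: s) := by
            simp only [pr_cons, map_mul, map_inv]; group
          have hr : Red ((⟨i, h⁻¹ * g⟩ : Σ i, G i) :: s) := by
            refine ⟨fun a ha => ?_, ?_⟩
            · rcases List.mem_cons.1 ha with rfl | ha
              · exact hgh
              · exact hx.tail.1 a ha
            · have := hx.2
              rw [List.isChain_cons] at this ⊢
              exact this
          rw [e, main _ _ hr hy.tail]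
          · simp only [wt_cons, tk, if_neg hab, hk]
            ring
          · intro a ha b hb
            simp only [List.head?_cons, Option.mem_def, Option.some.injEq] at ha
            subst ha
            have := hy.2
            rw [List.isChain_cons] at this
            exact this.1 b hb
        · rw [main _ _ hx hy (by simpa using hi)]
          simp [tk, hab, hk0 a b hi]

end

end FreeProdWH

namespace FreeProdWH

open Monoid Filter Topology

section
set_option linter.unusedSectionVars false
variable {ι : Type*} {G : ι → Type*} [∀ i, Group (G i)]

open Classical in
/-- Truncated version of the tree kernel. -/
noncomputable def tkN (M : (Σ i, G i) → ℝ) (k : (Σ i, G i) → (Σ i, G i) → ℝ) (d : Σ i, G i) :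
    ℕ → List (Σ i, G i) → List (Σ i, G i) → ℝ
  | 0, _, _ => 0
  | n + 1, x, y =>
    ((if x = [] then 0 else 1) * (if y = [] then 0 else 1)) *
      ((wt M x.tail * wt M y.tail) * k (x.headD d) (y.headD d) +
        (if x.headD d = y.headD d then 1 else 0) * tkN M k d n x.tail y.tail)

theorem tkN_pd (M : (Σ i, G i) → ℝ) (k : (Σ i, G i) → (Σ i, G i) → ℝ) (hk : PDK k)
    (d : Σ i, G i) (n : ℕ) : PDK (tkN M k d n) := by
  classical
  induction n with
  | zero => exact PDK.zero
  | succ n ih =>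
    have h1 := (PDK.rankOne (fun x : List (Σ i, G i) => wt M x.tail)).mul
      (hk.comap (fun x : List (Σ i, G i) => x.headD d))
    have h2 := ((PDK.eqKer (X := Σ i, G i)).comap
      (fun x : List (Σ i, G i) => x.headD d)).mul (ih.comap List.tail)
    have h3 := (PDK.rankOne (fun x : List (Σ i, G i) => if x = [] then (0 : ℝ) else 1)).mul
      (h1.add h2)
    convert h3 using 1
    funext x y
    simp only [tkN]

theorem tkN_eq (M : (Σ i, G i) → ℝ) (k : (Σ i, G i) → (Σ i, G i) → ℝ)
    (d : Σ i, G i) (n : ℕ) (x y : List (Σ i, G i)) (h : x.length ≤ n) :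
    tkN M k d n x y = tk M k x y := by
  induction n generalizing x y with
  | zero =>
    have : x = [] := List.length_eq_zero_iff.1 (by omega)
    subst this; simp [tkN, tk]
  | succ n ih =>
    cases x with
    | nil => simp [tkN, tk]
    | cons a s =>
      cases y with
      | nil => simp [tkN, tk]
      | cons b t =>
        have := ih s t (by simpa using h)
        simp only [tkN, tk, List.tail_cons, List.headD_cons, this]
        by_cases hab : a = b <;> simp [hab]

theorem tk_pd [Nonempty ι] (M : (Σ i, G i) → ℝ) (k : (Σ i, G i) → (Σ i, G i) → ℝ) (hk : PDK k) :
    PDK (tk M k) := by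
  let d : Σ i, G i := ⟨Classical.arbitrary ι, 1⟩
  refine PDK.of_tendsto (fun n => tkN_pd M k hk d n) fun x y => ?_
  refine tendsto_const_nhds.congr' ?_
  filter_upwards [eventually_ge_atTop x.length] with n hn
  exact (tkN_eq M k d n x y hn).symm

theorem wt_abs_le (M : (Σ i, G i) → ℝ) {ρ : ℝ} (hρ0 : 0 ≤ ρ)
    (hM : ∀ a, a.2 ≠ 1 → |M a| ≤ ρ) (x : List (Σ i, G i)) (hx : Red x) :
    |wt M x| ≤ ρ ^ x.length := by
  induction x with
  | nil => simp
  | cons a s ih =>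
    rw [wt_cons, abs_mul, List.length_cons, pow_succ']
    exact mul_le_mul (hM a (hx.1 a (by simp))) (ih hx.tail) (abs_nonneg _) hρ0

theorem wt_abs_le_mem (M : (Σ i, G i) → ℝ)
    (hM : ∀ a, a.2 ≠ 1 → |M a| ≤ 1) (x : List (Σ i, G i)) (hx : Red x) (a) (ha : a ∈ x) :
    |wt M x| ≤ |M a| := by
  induction x with
  | nil => simp at ha
  | cons b s ih =>
    have h1 := hM b (hx.1 b (by simp))
    have h2 := wt_abs_le M zero_le_one hM s hx.tail
    rw [one_pow] at h2
    rw [wt_cons, abs_mul]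
    rcases List.mem_cons.1 ha with rfl | ha
    · exact mul_le_of_le_one_right (abs_nonneg _) h2
    · exact (mul_le_of_le_one_left (abs_nonneg _) h1).trans (ih hx.tail ha)

theorem wt_near (M : (Σ i, G i) → ℝ) {τ : ℝ}
    (hM : ∀ a, a.2 ≠ 1 → |M a| ≤ 1) (x : List (Σ i, G i)) (hx : Red x)
    (h : ∀ a ∈ x, |1 - M a| ≤ τ) : |1 - wt M x| ≤ x.length * τ := by
  induction x with
  | nil => simp
  | cons b s ih =>
    have h1 := hM b (hx.1 b (by simp))
    have h2 := h b (by simp)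
    have h3 := ih hx.tail fun a ha => h a (by simp [ha])
    have e : 1 - wt M (b :: s) = (1 - M b) + M b * (1 - wt M s) := by rw [wt_cons]; ring
    rw [e]
    refine (abs_add_le _ _).trans ?_
    rw [abs_mul]
    have := mul_le_of_le_one_left (abs_nonneg (1 - wt M s)) h1
    push_cast [List.length_cons]
    linarith

theorem tk_diag (M : (Σ i, G i) → ℝ) {ρ δ : ℝ} (hρ0 : 0 ≤ ρ) (hρ1 : ρ ≤ 1) (hδ : 0 ≤ δ)
    (hM : ∀ a, a.2 ≠ 1 → |M a| ≤ ρ) (k : (Σ i, G i) → (Σ i, G i) → ℝ)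
    (hk : ∀ a, a.2 ≠ 1 → k a a ≤ δ) (x : List (Σ i, G i)) (hx : Red x) :
    tk M k x x * (1 - ρ) ≤ δ * (1 - ρ ^ x.length) := by
  induction x with
  | nil => simp [tk]
  | cons a s ih =>
    have h1 := ih hx.tail
    have h2 := wt_abs_le M hρ0 hM s hx.tail
    have h3 := hk a (hx.1 a (by simp))
    have h4 : ρ ^ s.length ≤ 1 := pow_le_one₀ hρ0 hρ1
    have h0 : 0 ≤ ρ ^ s.length := by positivity
    have h5 : wt M s * wt M s ≤ ρ ^ s.length := by
      rw [← abs_mul_abs_self]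
      nlinarith [abs_nonneg (wt M s)]
    have h6 : wt M s * wt M s * k a a ≤ ρ ^ s.length * δ :=
      (mul_le_mul_of_nonneg_left h3 (mul_self_nonneg _)).trans
        (mul_le_mul_of_nonneg_right h5 hδ)
    simp only [tk, if_true, List.length_cons, pow_succ]
    nlinarith [mul_le_mul_of_nonneg_right h6 (sub_nonneg.2 hρ1)]

/-- Direct sum of letter kernels. -/
noncomputable def sg [Fintype ι] [DecidableEq ι] (kk : ∀ i, G i → G i → ℝ) (a b : Σ i, G i) : ℝ :=
  ∑ i, ((if a.1 = i then 1 else 0) * (if b.1 = i then 1 else 0)) *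
    kk i ((Pi.mulSingle a.1 a.2 : ∀ i, G i) i) ((Pi.mulSingle b.1 b.2 : ∀ i, G i) i)

theorem sg_pd [Fintype ι] [DecidableEq ι] (kk : ∀ i, G i → G i → ℝ) (h : ∀ i, PDK (kk i)) :
    PDK (sg kk) :=
  PDK.sum _ fun i _ => (PDK.rankOne (fun a : Σ i, G i => if a.1 = i then (1 : ℝ) else 0)).mul
    ((h i).comap fun a : Σ i, G i => (Pi.mulSingle a.1 a.2 : ∀ i, G i) i)

theorem sg_same [Fintype ι] [DecidableEq ι] (kk : ∀ i, G i → G i → ℝ) (i) (g h : G i) :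
    sg kk ⟨i, g⟩ ⟨i, h⟩ = kk i g h := by
  rw [sg, Finset.sum_eq_single i]
  · simp
  · intro j _ hj
    simp [hj.symm]
  · simp

theorem sg_ne [Fintype ι] [DecidableEq ι] (kk : ∀ i, G i → G i → ℝ) (a b : Σ i, G i)
    (h : a.1 ≠ b.1) : sg kk a b = 0 := by
  refine Finset.sum_eq_zero fun j _ => ?_
  by_cases h1 : a.1 = j
  · have : b.1 ≠ j := fun h2 => h (h1.trans h2.symm)
    simp [this]
  · simp [h1]

theorem sg_sub [Fintype ι] [DecidableEq ι] (k k1 k2 : ∀ i, G i → G i → ℝ)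
    (h : ∀ i g h, k i g h = k1 i g h - k2 i g h) (a b : Σ i, G i) :
    sg k a b = sg k1 a b - sg k2 a b := by
  simp only [sg, ← Finset.sum_sub_distrib, h, mul_sub]

theorem finite_lists {L : Type*} {S : Set L} (hS : S.Finite) (N : ℕ) :
    {l : List L | l.length ≤ N ∧ ∀ a ∈ l, a ∈ S}.Finite := by
  have : Finite S := hS
  refine ((List.finite_length_le S N).image (List.map Subtype.val)).subset ?_
  rintro l ⟨h1, h2⟩
  refine ⟨l.attach.map fun a => ⟨a.1, h2 a.1 a.2⟩, by simpa using h1, ?_⟩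
  simp

end

end FreeProdWH

namespace FreeProdWH

open Monoid

theorem approx_coprodI {ι : Type*} [Fintype ι] [Nonempty ι] {G : ι → Type*} [∀ i, Group (G i)]
    (hG : ∀ i, ApproxWH (G i)) : ApproxWH (CoprodI G) := by
  classical
  intro F hF ε hε
  -- bound on the lengths of normal forms
  obtain ⟨N, hN⟩ : ∃ N : ℕ, ∀ w ∈ F, (nf w).length ≤ N := by
    obtain ⟨N, hN⟩ := (hF.image fun w => (nf w).length).bddAbove
    exact ⟨N, fun w hw => hN ⟨w, hw, rfl⟩⟩
  have hFi : ∀ i, {g : G i | ∃ w ∈ F, (⟨i, g⟩ : Σ i, G i) ∈ nf w}.Finite := by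
    intro i
    have : {a : Σ i, G i | ∃ w ∈ F, a ∈ nf w}.Finite := by
      have h := hF.biUnion (t := fun w => {a | a ∈ nf w}) fun w _ => List.finite_toSet _
      refine h.subset ?_
      rintro a ⟨w, hw, ha⟩
      exact Set.mem_biUnion hw ha
    exact this.preimage (f := Sigma.mk i) sigma_mk_injective.injOn
  -- parameters
  obtain ⟨τ, hτ0, hτ1, hτN⟩ : ∃ τ : ℝ, 0 < τ ∧ τ ≤ 1 ∧ N * τ ≤ ε := by
    refine ⟨min 1 (ε / (N + 1)), by positivity, min_le_left _ _, ?_⟩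
    have h1 : min 1 (ε / ((N : ℝ) + 1)) ≤ ε / (N + 1) := min_le_right _ _
    calc (N : ℝ) * min 1 (ε / (N + 1)) ≤ (N + 1) * (ε / (N + 1)) := by gcongr; linarith
      _ = ε := by field_simp
  obtain ⟨ε', hε'0, hε'1, hε'2⟩ : ∃ ε' : ℝ, 0 < ε' ∧ ε' ≤ τ / 8 ∧ 16 * ε' ≤ ε * τ :=
    ⟨min (τ / 8) (ε * τ / 16), by positivity, min_le_left _ _, by
      linarith [min_le_right (τ / 8) (ε * τ / 16)]⟩
  set r : ℝ := 1 - τ / 2 with hr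
  set ρ : ℝ := 1 - τ / 4 with hρ
  have hr0 : 0 < r := by linarith
  have hr1 : r ≤ 1 := by linarith
  choose m P Q hP hQ hm hm1 hQd hmF hmc using fun i => hG i _ (hFi i) ε' hε'0
  have hQabs : ∀ i x y, |Q i x y| ≤ ε' := fun i x y => by
    have := (hQ i).abs_le x y
    linarith [hQd i x, hQd i y]
  have hPd : ∀ i x, P i x x = 1 + Q i x x := fun i x => by
    have := hm i x x
    rw [inv_mul_cancel, hm1] at this; linarith
  have hmg : ∀ i g, m i g = P i g 1 - Q i g 1 := fun i g => by simpa using hm i g 1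
  have hmg' : ∀ i g, m i g⁻¹ = m i g := fun i g => by
    have := hm i 1 g
    rw [mul_one] at this
    rw [this, (hP i).1, (hQ i).1, hmg]
  have hmabs : ∀ i g, |m i g| ≤ 1 + 2 * ε' := fun i g => by
    rw [hmg]
    have h2 := (hP i).abs_le g 1
    have h3 := hQabs i g 1
    have := hPd i g
    have := hPd i 1
    have := abs_sub (P i g 1) (Q i g 1)
    linarith [hQd i g, hQd i 1]
  -- damped multipliers
  set μ : ∀ i, G i → ℝ := fun i g => r * m i g + (1 - r) * (if g = 1 then 1 else 0) with hμ
  have hμ1 : ∀ i, μ i 1 = 1 := fun i => by simp [hμ, hm1]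
  have hμne : ∀ i (g : G i), g ≠ 1 → μ i g = r * m i g := fun i g hg => by simp [hμ, hg]
  have hμρ : ∀ i (g : G i), g ≠ 1 → |μ i g| ≤ ρ := fun i g hg => by
    rw [hμne i g hg, abs_mul, abs_of_pos hr0]
    have := hmabs i g
    nlinarith
  have hμabs : ∀ i (g : G i), |μ i g| ≤ 1 := fun i g => by
    by_cases hg : g = 1
    · subst hg; simp [hμ1]
    · exact (hμρ i g hg).trans (by linarith)
  set PM : ∀ i, G i → G i → ℝ := fun i x y => r * P i x y + (1 - r) * (if x = y then 1 else 0)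
    with hPM
  set QM : ∀ i, G i → G i → ℝ := fun i x y => r * Q i x y with hQM
  have hPMpd : ∀ i, PDK (PM i) := fun i =>
    ((hP i).const_mul hr0.le).add (PDK.eqKer.const_mul (by linarith))
  have hQMpd : ∀ i, PDK (QM i) := fun i => (hQ i).const_mul hr0.le
  have hμPQ : ∀ i x y, μ i (y⁻¹ * x) = PM i x y - QM i x y := fun i x y => by
    simp only [hμ, hPM, hQM, hm, inv_mul_eq_one]
    simp only [eq_comm (a := y)]
    ring
  have hQMabs : ∀ i x y, |QM i x y| ≤ ε' := fun i x y => by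
    rw [hQM, abs_mul, abs_of_pos hr0]
    have := hQabs i x y
    nlinarith [abs_nonneg (Q i x y)]
  set kp : ∀ i, G i → G i → ℝ := fun i x y =>
    PM i x y - μ i y * PM i x 1 - μ i x * PM i 1 y + μ i x * μ i y * PM i 1 1 with hkp
  set km : ∀ i, G i → G i → ℝ := fun i x y =>
    QM i x y - μ i y * QM i x 1 - μ i x * QM i 1 y + μ i x * μ i y * QM i 1 1 with hkm
  set kk : ∀ i, G i → G i → ℝ := fun i x y => μ i (y⁻¹ * x) - μ i x * μ i y with hkk
  have hkppd : ∀ i, PDK (kp i) := fun i => (hPMpd i).proj (μ i) 1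
  have hkmpd : ∀ i, PDK (km i) := fun i => (hQMpd i).proj (μ i) 1
  have hksub : ∀ i x y, kk i x y = kp i x y - km i x y := fun i x y => by
    have e1 := hμPQ i x y
    have e2 := hμPQ i x 1
    have e3 := hμPQ i y 1
    have e4 := hμPQ i 1 1
    simp only [inv_one, one_mul, hμ1] at e2 e3 e4
    simp only [hkk, hkp, hkm]
    rw [(hPMpd i).1 1 y, (hQMpd i).1 1 y]
    have f2 : PM i x 1 = μ i x + QM i x 1 := by linarith
    have f3 : PM i y 1 = μ i y + QM i y 1 := by linarith
    have f4 : PM i 1 1 = 1 + QM i 1 1 := by linarith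
    rw [e1, f2, f3, f4]; ring
  have hkmd : ∀ i x, km i x x ≤ 4 * ε' := fun i x => by
    have h1 := (abs_le.1 (hQMabs i x x)).2
    have h2 : |μ i x * QM i x 1| ≤ ε' := by
      rw [abs_mul]
      exact (mul_le_of_le_one_left (abs_nonneg _) (hμabs i x)).trans (hQMabs i x 1)
    have h3 : |μ i x * μ i x * QM i 1 1| ≤ ε' := by
      rw [abs_mul, abs_mul]
      exact (mul_le_of_le_one_left (abs_nonneg _)
        (mul_le_one₀ (hμabs i x) (abs_nonneg _) (hμabs i x))).trans (hQMabs i 1 1)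
    have h4 := (abs_le.1 h2).1
    have h5 := (abs_le.1 h3).2
    simp only [hkm]
    rw [(hQMpd i).1 1 x]
    linarith
  set M : (Σ i, G i) → ℝ := fun a => μ a.1 a.2 with hM
  have hMρ : ∀ a : Σ i, G i, a.2 ≠ 1 → |M a| ≤ ρ := fun a ha => hμρ a.1 a.2 ha
  have hM1 : ∀ a : Σ i, G i, a.2 ≠ 1 → |M a| ≤ 1 := fun a ha => hμabs a.1 a.2
  have hμinv : ∀ i (g : G i), μ i g⁻¹ = μ i g := fun i g => by simp [hμ, hmg']
  have hTp : PDK (tk M (sg kp)) := tk_pd M _ (sg_pd _ hkppd)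
  have hTm : PDK (tk M (sg km)) := tk_pd M _ (sg_pd _ hkmpd)
  refine ⟨fun g => wt M (nf g), _, _, ((PDK.rankOne (wt M)).add hTp).comap nf, hTm.comap nf,
    fun x y => ?_, ?_, fun x => ?_, fun g hg => ?_, fun η hη => ?_⟩
  · have := tk_formula M (fun i g => hμinv i g) (fun i => hμ1 i) (sg kk)
      (fun i g h => sg_same kk i g h) (fun a b hab => sg_ne kk a b hab) (nf x) (nf y)
      (red_nf x) (red_nf y)
    rw [pr_nf, pr_nf, tk_sub M _ _ _ (sg_sub kk kp km hksub)] at this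
    beta_reduce
    rw [this]; ring
  · have : nf (1 : CoprodI G) = [] := by
      have := nf_pr (l := ([] : List (Σ i, G i))) ⟨by simp, by simp⟩
      simpa using this
    simp [this]
  · have h1 := tk_diag M (ρ := ρ) (δ := 4 * ε') (by linarith) (by linarith) (by positivity) hMρ
      (sg km) (fun a _ => by
        rw [show sg km a a = km a.1 a.2 a.2 from sg_same km a.1 a.2 a.2]; exact hkmd _ _)
      (nf x) (red_nf x)
    have h2 : 0 ≤ ρ ^ (nf x).length := pow_nonneg (by linarith) _
    have h3 : tk M (sg km) (nf x) (nf x) * (τ / 4) ≤ 4 * ε' := by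
      have e : 1 - ρ = τ / 4 := by rw [hρ]; ring
      rw [e] at h1
      nlinarith
    by_contra hlt
    push Not at hlt
    nlinarith
  · have h1 := wt_near M (τ := τ) hM1 (nf g) (red_nf g) (fun a ha => by
      have ha1 := (red_nf g).1 a ha
      have h2 := hmF a.1 a.2 ⟨g, hg, ha⟩
      rw [show M a = r * m a.1 a.2 from hμne _ _ ha1]
      rw [abs_le] at h2 ⊢
      constructor <;> nlinarith)
    have h2 : ((nf g).length : ℝ) ≤ N := by exact_mod_cast hN g hg
    exact (h1.trans (mul_le_mul_of_nonneg_right h2 hτ0.le)).trans hτN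
  · obtain ⟨n, hn⟩ := exists_pow_lt_of_lt_one hη (by linarith : ρ < 1)
    have hS : (⋃ i, Sigma.mk i '' {g : G i | η ≤ |m i g|}).Finite :=
      Set.finite_iUnion fun i => (hmc i η hη).image _
    refine Set.Finite.subset ((finite_lists hS n).preimage nf_injective.injOn) ?_
    intro g hg
    simp only [Set.mem_ofPred_eq] at hg
    refine ⟨?_, fun a ha => ?_⟩
    · by_contra hlt
      push Not at hlt
      have h1 := wt_abs_le M (by linarith) hMρ (nf g) (red_nf g)
      have h2 : ρ ^ (nf g).length ≤ ρ ^ n :=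
        pow_le_pow_of_le_one (by linarith) (by linarith) hlt.le
      linarith
    · have h1 := wt_abs_le_mem M hM1 (nf g) (red_nf g) a ha
      have ha1 := (red_nf g).1 a ha
      rw [show M a = r * m a.1 a.2 from hμne _ _ ha1, abs_mul, abs_of_pos hr0] at h1
      refine Set.mem_iUnion.2 ⟨a.1, a.2, ?_, rfl⟩
      simp only [Set.mem_ofPred_eq]
      exact (hg.trans h1).trans (mul_le_of_le_one_left (abs_nonneg _) hr1)

theorem whk_coprodI {ι : Type*} [Fintype ι] [Nonempty ι] {G : ι → Type*} [∀ i, Group (G i)]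
    (hG : ∀ i, WHK (G i)) : WHK (CoprodI G) := by
  classical
  have : ∀ i, Countable (G i) := fun i => (hG i).choose_spec.1.countable
  have : Countable (CoprodI G) := (nf_injective (G := G)).countable
  exact (approx_coprodI fun i => (hG i).approx).toWHK

/-- The two factors as a family in a common universe. -/
def Fam.{u, v} (A : Type u) (B : Type v) : Bool → Type (max u v)
  | true => ULift.{v} A
  | false => ULift.{u} B

instance famGroup.{u, v} (A : Type u) (B : Type v) [Group A] [Group B] :
    ∀ i, Group (Fam A B i)
  | true => inferInstanceAs (Group (ULift.{v} A))
  | false => inferInstanceAs (Group (ULift.{u} B))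

/-- Inclusion of the first factor. -/
def inA.{u, v} (A : Type u) (B : Type v) [Group A] [Group B] : A →* Fam A B true :=
  (MulEquiv.ulift.{u, v} (α := A)).symm.toMonoidHom

/-- Inclusion of the second factor. -/
def inB.{u, v} (A : Type u) (B : Type v) [Group A] [Group B] : B →* Fam A B false :=
  (MulEquiv.ulift.{v, u} (α := B)).symm.toMonoidHom

/-- Back to the binary coproduct. -/
def back.{u, v} (A : Type u) (B : Type v) [Group A] [Group B] :
    ∀ i, Fam A B i →* Monoid.Coprod A B
  | true => Coprod.inl.comp (MulEquiv.ulift.{u, v} (α := A)).toMonoidHom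
  | false => Coprod.inr.comp (MulEquiv.ulift.{v, u} (α := B)).toMonoidHom

theorem whk_coprod (A B : Type*) [Group A] [Group B] (hA : WHK A) (hB : WHK B) :
    WHK (Monoid.Coprod A B) := by
  have hfam : ∀ i, WHK (Fam A B i) := by
    rintro (_ | _)
    · exact hB.comap (MulEquiv.ulift (α := B)).toMonoidHom (MulEquiv.ulift (α := B)).injective
    · exact hA.comap (MulEquiv.ulift (α := A)).toMonoidHom (MulEquiv.ulift (α := A)).injective
  let f : Monoid.Coprod A B →* CoprodI (Fam A B) :=
    Coprod.lift (CoprodI.of.comp (inA A B)) (CoprodI.of.comp (inB A B))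
  let b : CoprodI (Fam A B) →* Monoid.Coprod A B := CoprodI.lift (back A B)
  have hbf : b.comp f = MonoidHom.id _ := by
    refine Coprod.hom_ext ?_ ?_
    · ext a; simp [b, f]; rfl
    · ext a; simp [b, f]; rfl
  refine (whk_coprodI hfam).comap f ?_
  exact Function.LeftInverse.injective (g := b) fun x => DFunLike.congr_fun hbf x

end FreeProdWH

/-- If `A` and `B` admit proper functions split as
`φ(y⁻¹x) = ‖R x - R y‖² + ‖S x + S y‖²`, then so does the free product `A ∗ B`. -/
theorem freeProduct_whOneData (A B : Type*) [Group A] [Group B]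
    (hA : Nonempty (WHOneData A)) (hB : Nonempty (WHOneData B)) :
    Nonempty (WHOneData (Monoid.Coprod A B)) := by
  obtain ⟨dA⟩ := hA
  obtain ⟨dB⟩ := hB
  exact (FreeProdWH.whk_coprod A B dA.toWHK dB.toWHK).toData
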